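/- Suppose f : ℝ → ℝ solves the safe-integration equation for (g₀, h₀, h₁). Then for every n ∈ ℕ and every x ∈ [2n+1, 2n+2], f(x) = f(2n+1) + (f(2n+2) − f(2n+1))·(p(x) − n). -/

import Mathlib

noncomputable def parity (x : ℝ) : ℝ := max 0 (Real.pi / 2 * Real.sin (Real.pi * x))

noncomputable def pfun (x : ℝ) : ℝ := ∫ t in (0:ℝ)..(x - 1), parity t

noncomputable def pfun' (x : ℝ) : ℝ := pfun (x - 1) + 1

def SolvesSafeIntegration (g0 : ℝ) (h0 h1 : ℝ → ℝ → ℝ) (f : ℝ → ℝ) : Prop :=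
  f 0 = g0 ∧ ∀ x : ℝ, HasDerivAt f
    (parity x * (h1 (pfun x) (f (pfun x)) - f (2 * pfun x)) +
     parity (x - 1) * (h0 (pfun' x) (f (pfun' x)) - f (2 * pfun' x - 1))) x

theorem continuous_parity : Continuous parity := by
  unfold parity
  fun_prop

theorem parity_of_mem_Icc_even {n : ℕ} {x : ℝ} (hx : x ∈ Set.Icc (2 * n : ℝ) (2 * n + 1)) :
    parity x = Real.pi / 2 * Real.sin (Real.pi * x) := by
  have hpi := Real.pi_pos
  apply max_eq_right
  rw [← Real.sin_sub_nat_mul_two_pi _ n]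
  have := Real.sin_nonneg_of_nonneg_of_le_pi (x := Real.pi * x - n * (2 * Real.pi))
    (by nlinarith [hx.1]) (by nlinarith [hx.2])
  positivity

theorem parity_of_mem_Icc_odd {n : ℕ} {x : ℝ} (hx : x ∈ Set.Icc (2 * n - 1 : ℝ) (2 * n)) :
    parity x = 0 := by
  have hpi := Real.pi_pos
  apply max_eq_left
  rw [← Real.sin_sub_nat_mul_two_pi _ n]
  have := Real.sin_nonpos_of_nonpos_of_neg_pi_le (x := Real.pi * x - n * (2 * Real.pi))
    (by nlinarith [hx.2]) (by nlinarith [hx.1])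
  exact mul_nonpos_of_nonneg_of_nonpos (by positivity) this

theorem pfun_sub_pfun (x y : ℝ) : pfun y - pfun x = ∫ t in (x - 1)..(y - 1), parity t :=
  intervalIntegral.integral_interval_sub_left
    (continuous_parity.intervalIntegrable _ _) (continuous_parity.intervalIntegrable _ _)

theorem hasDerivAt_pfun (x : ℝ) : HasDerivAt pfun (parity (x - 1)) x := by
  have h := intervalIntegral.integral_hasDerivAt_right (a := 0) (b := x - 1)
    (continuous_parity.intervalIntegrable _ _)
    continuous_parity.stronglyMeasurable.stronglyMeasurableAtFilter
    continuous_parity.continuousAt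
  exact h.comp_sub_const x 1

theorem pfun_eq_of_mem_Icc {n : ℕ} {x y : ℝ} (hx : x ∈ Set.Icc (2 * n : ℝ) (2 * n + 1))
    (hy : y ∈ Set.Icc (2 * n : ℝ) (2 * n + 1)) : pfun x = pfun y := by
  rw [← sub_eq_zero, pfun_sub_pfun]
  apply intervalIntegral.integral_zero_ae
  refine Filter.Eventually.of_forall fun t ht => parity_of_mem_Icc_odd (n := n) ?_
  refine Set.uIcc_subset_Icc ?_ ?_ (Set.uIoc_subset_uIcc ht) <;>
    constructor <;> linarith [hx.1, hx.2, hy.1, hy.2]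

theorem integral_parity_even (n : ℕ) : ∫ t in (2 * n : ℝ)..(2 * n + 1), parity t = 1 := by
  have hderiv (t : ℝ) : HasDerivAt (fun t => -Real.cos (Real.pi * t) / 2)
      (Real.pi / 2 * Real.sin (Real.pi * t)) t := by
    refine (((hasDerivAt_id t).const_mul Real.pi).cos.neg.div_const 2).congr_deriv ?_
    simp only [id]
    ring
  have hcongr : ∫ t in (2 * n : ℝ)..(2 * n + 1), parity t =
      ∫ t in (2 * n : ℝ)..(2 * n + 1), Real.pi / 2 * Real.sin (Real.pi * t) := by
    refine intervalIntegral.integral_congr fun t ht => parity_of_mem_Icc_even (n := n) ?_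
    rwa [Set.uIcc_of_le (by linarith)] at ht
  rw [hcongr, intervalIntegral.integral_eq_sub_of_hasDerivAt (fun t _ => hderiv t)
    (Continuous.intervalIntegrable (by fun_prop) _ _)]
  rw [show Real.pi * (2 * n + 1) = n * (2 * Real.pi) + Real.pi by ring,
    show Real.pi * (2 * n) = n * (2 * Real.pi) by ring,
    Real.cos_nat_mul_two_pi_add_pi, Real.cos_nat_mul_two_pi]
  norm_num

theorem pfun_even_add_two (n : ℕ) : pfun (2 * n + 2) = pfun (2 * n + 1) + 1 := by
  rw [← sub_eq_iff_eq_add', pfun_sub_pfun]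
  convert integral_parity_even n using 2 <;> ring

theorem pfun_odd (n : ℕ) : pfun (2 * n + 1) = n := by
  induction n with
  | zero => simp [pfun]
  | succ k ih =>
    rw [pfun_eq_of_mem_Icc (n := k + 1) (y := 2 * k + 2)
      (by push_cast; constructor <;> linarith) (by push_cast; constructor <;> linarith),
      pfun_even_add_two, ih]
    push_cast
    rfl

theorem pfun_of_mem_Icc {n : ℕ} {x : ℝ} (hx : x ∈ Set.Icc (2 * n : ℝ) (2 * n + 1)) :
    pfun x = n :=
  (pfun_eq_of_mem_Icc hx ⟨by linarith, le_rfl⟩).trans (pfun_odd n)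

theorem safe_integration_odd_interval (g0 : ℝ) (h0 h1 : ℝ → ℝ → ℝ) (f : ℝ → ℝ)
    (hf : SolvesSafeIntegration g0 h0 h1 f) :
    ∀ n : ℕ, ∀ x ∈ Set.Icc ((2*n + 1 : ℝ)) (2*n + 2),
      f x = f (2*n + 1) + (f (2*n + 2) - f (2*n + 1)) * (pfun x - n) := by
  intro n
  obtain ⟨C, hC⟩ : ∃ C, C = h0 (n + 1) (f (n + 1)) - f (2 * (n + 1) - 1) := ⟨_, rfl⟩
  have hderiv : ∀ x ∈ Set.Icc (2 * n + 1 : ℝ) (2 * n + 2),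
      HasDerivAt (fun x => f x - C * pfun x) 0 x := by
    intro x hx
    have hzero : parity x = 0 := parity_of_mem_Icc_odd (n := n + 1)
      (by push_cast; constructor <;> linarith [hx.1, hx.2])
    have hp : pfun' x = n + 1 := by
      rw [pfun', pfun_of_mem_Icc (n := n) (by constructor <;> linarith [hx.1, hx.2])]
    refine ((hf.2 x).sub ((hasDerivAt_pfun x).const_mul C)).congr_deriv ?_
    rw [hzero, hp, hC]
    ring
  have hconst := constant_of_has_deriv_right_zero
    (fun x hx => (hderiv x hx).continuousAt.continuousWithinAt)
    (fun x hx => (hderiv x (Set.Ico_subset_Icc_self hx)).hasDerivWithinAt)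
  intro x hx
  have hx' := hconst x hx
  have hend := hconst (2 * n + 2) ⟨by linarith, le_rfl⟩
  simp only [pfun_even_add_two, pfun_odd] at hx' hend
  have hslope : f (2 * n + 2) - f (2 * n + 1) = C := by linarith
  rw [hslope]
  linarith
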